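/- Assume the Riemann Hypothesis. Fix ε > 0, a weight W as described, and real numbers c₁, c₂ with 1 < c₁ < c₂ < 2. Then for all large real numbers y > x > 0, C₂ := (1/(2πi))² ∫_{Re s₁ = c₁} ∫_{Re s₂ = c₂} (ζ(2−s₂) ζ(1−s₂+s₁) / (ζ(2+s₁−s₂) ζ(s₂))) · y^{2−s₂} Ŵ(2−s₂) x^{s₁+s₂} Ŵ(s₁) Ŵ(s₂) ds₂ ds₁ satisfies |C₂| ≪ y^{1/2+ε} x^{3/2+ε}, with an implied constant depending only on ε, c₁, c₂ and W. -/

import Mathlib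

open Complex Filter

/-- The Ramanujan sum `c_q(n) = ∑_{a mod q, gcd(a,q)=1} e(na/q)`. -/
noncomputable def ramanujanSum (q n : ℕ) : ℂ :=
  ∑ a ∈ (Finset.range q).filter (fun a => Nat.Coprime a q),
    Complex.exp (2 * Real.pi * Complex.I * (((n * a : ℕ) : ℂ) / (q : ℂ)))

/-- A smooth weight function attached to a parameter `U ≥ 2`: `0 ≤ W ≤ 1`, supported in
`[1/(2U), 1 + 1/(2U)]`, equal to `1` on `[1/U, 1]`, with `j`-th derivative `≪_j U^j`. -/
structure Weight (U : ℝ) : Type where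
  toFun : ℝ → ℝ
  smooth : ContDiff ℝ (⊤ : ℕ∞) toFun
  nonneg : ∀ t, 0 ≤ toFun t
  le_one : ∀ t, toFun t ≤ 1
  support_subset : ∀ t, t ∉ Set.Icc (1 / (2 * U)) (1 + 1 / (2 * U)) → toFun t = 0
  eq_one : ∀ t ∈ Set.Icc (1 / U) 1, toFun t = 1
  deriv_bound : ∀ j : ℕ, ∃ Cj : ℝ, ∀ t, |iteratedDeriv j toFun t| ≤ Cj * U ^ j

/-- The Mellin transform `Ŵ(s) = ∫_0^∞ W(t) t^{s-1} dt`. -/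
noncomputable def mellinW (W : ℝ → ℝ) (s : ℂ) : ℂ :=
  ∫ t in Set.Ioi (0 : ℝ), (W t : ℂ) * (t : ℂ) ^ (s - 1)

/-- `(1/(2πi)) ∫_{Re s = c} f(s) ds`, the normalized vertical line integral. -/
noncomputable def VI (c : ℝ) (f : ℂ → ℂ) : ℂ :=
  (1 / (2 * Real.pi * Complex.I)) * ∫ t : ℝ, f (c + t * Complex.I) * Complex.I

/-- The smoothed second moment `C(x,y) = ∑_n (∑_q c_q(n) W(q/x))² W(n/y)`. -/
noncomputable def Cxy {U : ℝ} (W : Weight U) (x y : ℝ) : ℂ :=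
  ∑' n : ℕ+, (∑' q : ℕ+, ramanujanSum q n * (W.toFun ((q : ℕ) / x) : ℂ)) ^ 2
    * (W.toFun ((n : ℕ) / y) : ℂ)

/-- The generalized divisor sum `σ_z(n) = ∑_{d ∣ n} d^z`. -/
noncomputable def sigmaC (z : ℂ) (n : ℕ) : ℂ := ∑ d ∈ n.divisors, (d : ℂ) ^ z

/-- The error of the trapezoidal rule for `∫ x in a..a + 1, x ^ (-s)`, multiplied by `s - 1`. -/
noncomputable def trapezoidError (a : ℝ) (s : ℂ) : ℂ :=
  (s - 1) * ((a : ℂ) ^ (-s) + ((a + 1 : ℝ) : ℂ) ^ (-s)) / 2 + ((a + 1 : ℝ) : ℂ) ^ (1 - s)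
    - (a : ℂ) ^ (1 - s)

lemma hasDerivAt_add_cpow {a : ℝ} (ha : 0 < a) (r : ℂ) {h : ℝ} (hh : 0 ≤ h) :
    HasDerivAt (fun h : ℝ => ((a + h : ℝ) : ℂ) ^ r) (r * ((a + h : ℝ) : ℂ) ^ (r - 1)) h := by
  have hmem : (a : ℂ) + (h : ℂ) ∈ slitPlane := by
    rw [← ofReal_add]; exact ofReal_mem_slitPlane.2 (by linarith)
  have := (((hasDerivAt_id (h : ℂ)).const_add (a : ℂ)).cpow_const (c := r) hmem).comp_ofReal
  simpa using this

lemma norm_trapezoidError_le {a : ℝ} (ha : 0 < a) {s : ℂ} (hs : -2 ≤ s.re) :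
    ‖trapezoidError a s‖ ≤ ‖(s - 1) * s * (s + 1)‖ / 2 * a ^ (-s.re - 2) := by
  set C := ‖(s - 1) * s * (s + 1)‖ / 2 * a ^ (-s.re - 2) with hC
  have hC0 : 0 ≤ C := by positivity
  let ψ : ℝ → ℂ := fun h => (s - 1) / 2 * ((a : ℂ) ^ (-s) - ((a + h : ℝ) : ℂ) ^ (-s)
    - s * h * ((a + h : ℝ) : ℂ) ^ (-s - 1))
  let φ : ℝ → ℂ := fun h => (s - 1) * ((a : ℂ) ^ (-s) + ((a + h : ℝ) : ℂ) ^ (-s)) * h / 2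
    + ((a + h : ℝ) : ℂ) ^ (1 - s) - (a : ℂ) ^ (1 - s)
  have hof (h : ℝ) : HasDerivAt (fun h : ℝ => (h : ℂ)) 1 h := ofRealCLM.hasDerivAt
  have hψ (h : ℝ) (hh : h ∈ Set.Icc (0 : ℝ) 1) : HasDerivAt ψ
      ((s - 1) * s * (s + 1) / 2 * h * ((a + h : ℝ) : ℂ) ^ (-s - 2)) h := by
    have h1 := hasDerivAt_add_cpow ha (-s) hh.1
    have h2 := hasDerivAt_add_cpow ha (-s - 1) hh.1
    convert! (((hasDerivAt_const h ((a : ℂ) ^ (-s))).sub h1).sub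
      (((hof h).const_mul s).mul h2)).const_mul ((s - 1) / 2) using 1
    rw [show -s - 1 - 1 = -s - 2 by ring]
    ring
  have hφ (h : ℝ) (hh : h ∈ Set.Icc (0 : ℝ) 1) : HasDerivAt φ (ψ h) h := by
    have h1 := hasDerivAt_add_cpow ha (-s) hh.1
    have h2 := hasDerivAt_add_cpow ha (1 - s) hh.1
    convert! ((((((hasDerivAt_const h ((a : ℂ) ^ (-s))).add h1).const_mul (s - 1)).mul
      (hof h)).div_const 2).add h2).sub_const ((a : ℂ) ^ (1 - s)) using 1
    rw [show 1 - s - 1 = -s by ring]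
    simp only [ψ, Pi.add_apply]
    ring
  have hψ' (h : ℝ) (hh : h ∈ Set.Icc (0 : ℝ) 1) :
      ‖(s - 1) * s * (s + 1) / 2 * h * ((a + h : ℝ) : ℂ) ^ (-s - 2)‖ ≤ C := by
    have hah : 0 < a + h := by linarith [hh.1]
    rw [norm_mul, norm_mul, norm_cpow_eq_rpow_re_of_pos hah, norm_div, norm_real,
      Real.norm_of_nonneg hh.1, norm_ofNat, hC]
    have : (-s - 2).re = -s.re - 2 := by simp
    rw [this]
    have h3 : (a + h) ^ (-s.re - 2) ≤ a ^ (-s.re - 2) :=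
      Real.rpow_le_rpow_of_nonpos ha (by linarith [hh.1]) (by linarith)
    calc _ ≤ ‖(s - 1) * s * (s + 1)‖ / 2 * 1 * a ^ (-s.re - 2) := by
          gcongr
          exact hh.2
      _ = _ := by ring
  have hψC (h : ℝ) (hh : h ∈ Set.Icc (0 : ℝ) 1) : ‖ψ h‖ ≤ C := by
    have := (convex_Icc (0 : ℝ) 1).norm_image_sub_le_of_norm_hasDerivWithin_le
      (fun x hx => (hψ x hx).hasDerivWithinAt) hψ' (Set.left_mem_Icc.2 zero_le_one) hh
    have h0 : ψ 0 = 0 := by simp [ψ]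
    rw [h0, sub_zero, sub_zero, Real.norm_of_nonneg hh.1] at this
    nlinarith [hh.2]
  have := norm_image_sub_le_of_norm_deriv_le_segment_01'
    (fun x hx => (hφ x hx).hasDerivWithinAt) (fun x hx => hψC x ⟨hx.1, hx.2.le⟩)
  simpa [φ, trapezoidError] using this

lemma differentiable_trapezoidError {a : ℝ} (ha : 0 < a) :
    Differentiable ℂ (trapezoidError a) := by
  have h1 : (a : ℂ) ≠ 0 := by exact_mod_cast ha.ne'
  have h2 : ((a + 1 : ℝ) : ℂ) ≠ 0 := by exact_mod_cast (by linarith : a + 1 ≠ 0)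
  have h (b : ℂ) (hb : b ≠ 0) (f : ℂ → ℂ) (hf : Differentiable ℂ f) :
      Differentiable ℂ (fun s => b ^ f s) := fun s => (hf s).const_cpow (Or.inl hb)
  unfold trapezoidError
  exact ((((differentiable_id.sub_const 1).mul ((h _ h1 _ differentiable_neg).add
    (h _ h2 _ differentiable_neg))).div_const 2).add
    (h _ h2 _ (differentiable_id.const_sub 1))).sub (h _ h1 _ (differentiable_id.const_sub 1))

lemma hasSum_trapezoidError {s : ℂ} (hs : 1 < s.re) :
    HasSum (fun n : ℕ => trapezoidError (n + 1) s) (riemannZeta₁ s - 1 - (s - 1) / 2) := by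
  have hs1 : s ≠ 1 := by rintro rfl; simp at hs
  have hsum : Summable (fun n : ℕ => 1 / ((n : ℂ) + 1) ^ s) := by
    simpa using (summable_nat_add_iff 1).2 (Complex.summable_one_div_nat_cpow.2 hs)
  have h1 : HasSum (fun n : ℕ => ((n + 1 : ℝ) : ℂ) ^ (-s)) (riemannZeta s) := by
    rw [zeta_eq_tsum_one_div_nat_add_one_cpow hs]
    convert! hsum.hasSum using 2 with n
    simp [cpow_neg]
  have h2 : HasSum (fun n : ℕ => ((n + 1 + 1 : ℝ) : ℂ) ^ (-s)) (riemannZeta s - 1) := by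
    have := (hasSum_nat_add_iff' 1).2 h1
    simpa using this
  have h3 : Tendsto (fun n : ℕ => ∑ i ∈ Finset.range n,
      (((i + 1 + 1 : ℝ) : ℂ) ^ (1 - s) - ((i + 1 : ℝ) : ℂ) ^ (1 - s))) atTop (nhds (-1)) := by
    have (n : ℕ) : ∑ i ∈ Finset.range n,
        (((i + 1 + 1 : ℝ) : ℂ) ^ (1 - s) - ((i + 1 : ℝ) : ℂ) ^ (1 - s))
        = ((n + 1 : ℝ) : ℂ) ^ (1 - s) - 1 := by
      have := Finset.sum_range_sub (fun i : ℕ => ((i + 1 : ℝ) : ℂ) ^ (1 - s)) n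
      simpa using this
    simp_rw [this]
    rw [← zero_sub]
    refine Tendsto.sub_const ?_ 1
    rw [tendsto_zero_iff_norm_tendsto_zero]
    have h4 : Tendsto (fun n : ℕ => ((n : ℝ) + 1) ^ (-(s.re - 1))) atTop (nhds 0) :=
      (tendsto_rpow_neg_atTop (by linarith)).comp
        (tendsto_atTop_add_const_right _ 1 tendsto_natCast_atTop_atTop)
    convert h4 using 2 with n
    rw [norm_cpow_eq_rpow_re_of_pos (by positivity)]
    simp
  have hsummable : Summable (fun n : ℕ => trapezoidError (n + 1) s) := by
    have hb : Summable (fun n : ℕ => ‖(s - 1) * s * (s + 1)‖ / 2 *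
        ((n : ℝ) + 1) ^ (-s.re - 2)) := by
      refine Summable.mul_left _ ?_
      have := (summable_nat_add_iff 1).2 (Real.summable_nat_rpow.2 (by linarith : -s.re - 2 < -1))
      simpa using this
    exact Summable.of_norm_bounded hb
      fun n => norm_trapezoidError_le (by positivity) (by linarith)
  rw [hsummable.hasSum_iff_tendsto_nat]
  have h5 := (((h1.add h2).mul_left ((s - 1) / 2)).tendsto_sum_nat).add h3
  convert h5 using 2 with n
  · rw [← Finset.sum_add_distrib]
    refine Finset.sum_congr rfl fun i _ => ?_
    simp only [trapezoidError]
    ring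
  · rw [riemannZeta_eq_inv_sub_mul hs1]
    have : s - 1 ≠ 0 := sub_ne_zero.2 hs1
    field_simp
    ring

lemma exists_norm_riemannZeta₁_le :
    ∃ C : ℝ, 0 < C ∧ ∀ s : ℂ, -(1 / 2) < s.re → ‖riemannZeta₁ s‖ ≤ C * (1 + ‖s‖) ^ 3 := by
  have hsum : Summable (fun n : ℕ => ((n : ℝ) + 1) ^ (-(3 / 2) : ℝ)) := by
    have := (summable_nat_add_iff 1).2
      (Real.summable_nat_rpow.2 (by norm_num : (-(3 / 2) : ℝ) < -1))
    simpa using this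
  have hterm (n : ℕ) (s : ℂ) (hs : -(1 / 2) < s.re) :
      ‖trapezoidError (n + 1) s‖ ≤ (1 + ‖s‖) ^ 3 * ((n : ℝ) + 1) ^ (-(3 / 2) : ℝ) := by
    refine (norm_trapezoidError_le (by positivity) (by linarith)).trans ?_
    have h1 : ((n : ℝ) + 1) ^ (-s.re - 2) ≤ ((n : ℝ) + 1) ^ (-(3 / 2) : ℝ) :=
      Real.rpow_le_rpow_of_exponent_le (by simp) (by linarith)
    have h2 : ‖(s - 1) * s * (s + 1)‖ ≤ (1 + ‖s‖) ^ 3 := by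
      rw [norm_mul, norm_mul]
      have h3 : ‖s - 1‖ ≤ 1 + ‖s‖ := (norm_sub_le _ _).trans (by simp [add_comm])
      have h4 : ‖s + 1‖ ≤ 1 + ‖s‖ := (norm_add_le _ _).trans (by simp [add_comm])
      calc _ ≤ (1 + ‖s‖) * (1 + ‖s‖) * (1 + ‖s‖) := by
            gcongr
            linarith
        _ = _ := by ring
    gcongr
    linarith [norm_nonneg ((s - 1) * s * (s + 1))]
  set T := ∑' n : ℕ, ((n : ℝ) + 1) ^ (-(3 / 2) : ℝ) with hT
  have hT0 : 0 ≤ T := tsum_nonneg fun n => by positivity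
  have hformula (s : ℂ) (hs : -(1 / 2) < s.re) :
      riemannZeta₁ s = 1 + (s - 1) / 2 + ∑' n : ℕ, trapezoidError (n + 1) s := by
    set U := {z : ℂ | -(1 / 2) < z.re} ∩ Metric.ball 0 (‖s‖ + 3) with hU
    have hUo : IsOpen U := (isOpen_lt continuous_const continuous_re).inter Metric.isOpen_ball
    have hUc : IsPreconnected U :=
      ((convex_halfSpace_re_gt _).inter (convex_ball 0 _)).isPreconnected
    have hG : DifferentiableOn ℂ
        (fun s => 1 + (s - 1) / 2 + ∑' n : ℕ, trapezoidError (n + 1) s) U := by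
      refine DifferentiableOn.add (by fun_prop) ?_
      refine differentiableOn_tsum_of_summable_norm
        (hsum.mul_left ((1 + (‖s‖ + 3)) ^ 3))
        (fun n => (differentiable_trapezoidError (by positivity)).differentiableOn) hUo ?_
      intro n w hw
      refine (hterm n w hw.1).trans ?_
      have : ‖w‖ ≤ ‖s‖ + 3 := (mem_ball_zero_iff.1 hw.2).le
      gcongr
    have h2U : (2 : ℂ) ∈ U := by
      refine ⟨by norm_num [Set.mem_ofPred_eq], ?_⟩
      rw [mem_ball_zero_iff, norm_ofNat]
      linarith [norm_nonneg s]
    refine AnalyticOnNhd.eqOn_of_preconnected_of_eventuallyEq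
      (differentiable_riemannZeta₁.differentiableOn.analyticOnNhd hUo)
      (hG.analyticOnNhd hUo) hUc h2U ?_
      ⟨hs, by rw [mem_ball_zero_iff]; linarith⟩
    have : ∀ᶠ z : ℂ in nhds 2, 1 < z.re :=
      (isOpen_lt continuous_const continuous_re).mem_nhds (by norm_num [Set.mem_ofPred_eq])
    filter_upwards [this] with z hz
    rw [(hasSum_trapezoidError hz).tsum_eq]
    ring
  refine ⟨2 + T, by positivity, fun s hs => ?_⟩
  rw [hformula s hs]
  have h1 : ‖∑' n : ℕ, trapezoidError (n + 1) s‖ ≤ (1 + ‖s‖) ^ 3 * T := by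
    rw [hT, ← tsum_mul_left]
    exact tsum_of_norm_bounded (hsum.mul_left _).hasSum fun n => hterm n s hs
  have h2 : ‖1 + (s - 1) / 2‖ ≤ 1 + ‖s‖ := by
    rw [show 1 + (s - 1) / 2 = (1 + s) / 2 by ring, norm_div, norm_ofNat]
    have := norm_add_le 1 s
    rw [norm_one] at this
    linarith [norm_nonneg s]
  have h3 : 1 + ‖s‖ ≤ (1 + ‖s‖) ^ 3 := le_self_pow₀ (by simp) (by norm_num)
  calc _ ≤ ‖1 + (s - 1) / 2‖ + ‖∑' n : ℕ, trapezoidError (n + 1) s‖ := norm_add_le _ _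
    _ ≤ (2 + T) * (1 + ‖s‖) ^ 3 := by nlinarith [norm_nonneg s]

lemma exists_eq_mul_exp_of_ne_zero_on_ball {f : ℂ → ℂ} {c : ℂ} {R : ℝ} (hR : 0 < R)
    (hf : DifferentiableOn ℂ f (Metric.ball c R)) (hf0 : ∀ z ∈ Metric.ball c R, f z ≠ 0) :
    ∃ g : ℂ → ℂ, g c = 0 ∧ DifferentiableOn ℂ g (Metric.ball c R) ∧
      ∀ z ∈ Metric.ball c R, f z = f c * exp (g z) := by
  have hc : c ∈ Metric.ball c R := Metric.mem_ball_self hR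
  have hf' : DifferentiableOn ℂ (fun z => deriv f z / f z) (Metric.ball c R) :=
    (hf.deriv Metric.isOpen_ball).div hf hf0
  obtain ⟨g, hg0, hg⟩ := hf'.isExactOn_ball.with_val_at c 0
  have hgd : DifferentiableOn ℂ g (Metric.ball c R) :=
    fun z hz => (hg z hz).differentiableAt.differentiableWithinAt
  refine ⟨g, hg0, hgd, fun z hz => ?_⟩
  have hderiv (w : ℂ) (hw : w ∈ Metric.ball c R) :
      HasDerivAt (fun z => f z * exp (-g z)) 0 w := by
    have hfw := (hf.differentiableAt (Metric.isOpen_ball.mem_nhds hw)).hasDerivAt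
    convert! hfw.mul (hg w hw).neg.cexp using 1
    field_simp [hf0 w hw]
    ring
  have hconst := Metric.isOpen_ball.is_const_of_deriv_eq_zero (convex_ball c R).isPreconnected
    (fun w hw => (hderiv w hw).differentiableAt.differentiableWithinAt)
    (fun w hw => (hderiv w hw).deriv) hz hc
  simp only [hg0, neg_zero, exp_zero, mul_one] at hconst
  rw [← hconst, mul_assoc, ← exp_add, neg_add_cancel, exp_zero, mul_one]

lemma RiemannHypothesis.riemannZeta₁_ne_zero (hRH : RiemannHypothesis) {s : ℂ}
    (hs : 1 / 2 < s.re) : riemannZeta₁ s ≠ 0 := by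
  intro h
  by_cases hs1 : s = 1
  · simp [hs1] at h
  have hζ : riemannZeta s = 0 := by rw [riemannZeta_eq_inv_sub_mul hs1, h, mul_zero]
  have := hRH s hζ (by
    rintro ⟨n, rfl⟩
    have : ((-2 : ℂ) * (n + 1)).re = -2 * ((n : ℝ) + 1) := by simp
    rw [this] at hs
    linarith [(Nat.cast_nonneg n : (0 : ℝ) ≤ n)]) hs1
  linarith

lemma one_div_four_le_norm_riemannZeta₁ {s : ℂ} (hs : s.re = 2) : 1 / 4 ≤ ‖riemannZeta₁ s‖ := by
  have hs1 : s ≠ 1 := by rintro rfl; simp at hs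
  have hsum : Summable (fun n : ℕ => 1 / ((n : ℂ) + 1) ^ s) := by
    simpa using (summable_nat_add_iff 1).2 (Complex.summable_one_div_nat_cpow.2 (by linarith))
  have h1 : HasSum (fun n : ℕ => 1 / ((n : ℂ) + 1) ^ s) (riemannZeta s) := by
    rw [zeta_eq_tsum_one_div_nat_add_one_cpow (by linarith)]
    exact hsum.hasSum
  have h2 : HasSum (fun n : ℕ => 1 / ((n : ℂ) + 1 + 1) ^ s) (riemannZeta s - 1) := by
    simpa using (hasSum_nat_add_iff' 1).2 h1
  have h3 : HasSum (fun n : ℕ => 1 / ((n : ℝ) + 1 + 1) ^ 2) (Real.pi ^ 2 / 6 - 1) := by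
    have := (hasSum_nat_add_iff' 2).2 hasSum_zeta_two
    simpa [Finset.sum_range_succ, add_assoc, one_add_one_eq_two] using this
  have h4 : ‖riemannZeta s - 1‖ ≤ Real.pi ^ 2 / 6 - 1 := by
    rw [← h2.tsum_eq]
    refine tsum_of_norm_bounded h3 fun n => ?_
    have : ((n : ℂ) + 1 + 1) = ((n + 1 + 1 : ℝ) : ℂ) := by push_cast; ring
    rw [norm_div, norm_one, this, norm_cpow_eq_rpow_re_of_pos (by positivity), hs]
    norm_num
  have h5 : 1 / 4 ≤ ‖riemannZeta s‖ := by
    have := norm_sub_norm_le (1 : ℂ) (1 - riemannZeta s)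
    rw [sub_sub_cancel, norm_one, norm_sub_rev] at this
    nlinarith [Real.pi_lt_d2, Real.pi_pos]
  have h6 : 1 ≤ ‖s - 1‖ := by
    have := abs_re_le_norm (s - 1)
    rw [sub_re, hs, one_re] at this
    norm_num at this
    exact this
  have h7 : riemannZeta₁ s = (s - 1) * riemannZeta s := by
    rw [riemannZeta_eq_inv_sub_mul hs1, mul_inv_cancel_left₀ (sub_ne_zero.2 hs1)]
  rw [h7, norm_mul]
  nlinarith

lemma RiemannHypothesis.exists_norm_inv_riemannZeta₁_le (hRH : RiemannHypothesis) {δ : ℝ}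
    (hδ : 0 < δ) : ∃ A : ℕ, ∃ C : ℝ, 0 < C ∧ ∀ s : ℂ, 1 / 2 + δ ≤ s.re → s.re ≤ 2 →
      ‖(riemannZeta₁ s)⁻¹‖ ≤ C * (1 + ‖s‖) ^ A := by
  obtain ⟨C₀, hC₀, hZ⟩ := exists_norm_riemannZeta₁_le
  obtain ⟨A, hA⟩ := exists_nat_ge (3 / δ)
  set K : ℝ := 500 * C₀ + 2 with hK
  refine ⟨3 * A, 4 * K ^ A, by positivity, fun s hs hs2 => ?_⟩
  set c : ℂ := 2 + s.im * I with hc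
  have hcre : c.re = 2 := by simp [hc]
  have hsc : s - c = ((s.re - 2 : ℝ) : ℂ) := by
    apply Complex.ext <;> simp [hc]
  have hscn : ‖s - c‖ = 2 - s.re := by
    rw [hsc, norm_real, Real.norm_eq_abs, abs_of_nonpos (by linarith)]
    ring
  have hcn : ‖c‖ ≤ 2 + ‖s‖ := by
    refine (norm_add_le _ _).trans ?_
    simpa using abs_im_le_norm s
  have hball (z : ℂ) (hz : z ∈ Metric.ball c (3 / 2)) : 1 / 2 < z.re ∧ ‖z‖ ≤ ‖s‖ + 7 / 2 := by
    rw [mem_ball_iff_norm] at hz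
    constructor
    · have h' := (abs_lt.1 ((abs_re_le_norm (z - c)).trans_lt hz)).1
      rw [sub_re, hcre] at h'
      linarith
    · have := norm_add_le (z - c) c
      rw [sub_add_cancel] at this
      linarith
  obtain ⟨g, hg0, hgd, hg⟩ := exists_eq_mul_exp_of_ne_zero_on_ball (by norm_num : (0 : ℝ) < 3 / 2)
    (differentiable_riemannZeta₁.differentiableOn (s := Metric.ball c (3 / 2)))
    (fun z hz => hRH.riemannZeta₁_ne_zero (hball z hz).1)
  have hZc := one_div_four_le_norm_riemannZeta₁ hcre
  have h1s : 1 ≤ (1 + ‖s‖) ^ 3 := one_le_pow₀ (by simp)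
  set M := Real.log (K * (1 + ‖s‖) ^ 3) with hM
  have hM0 : 0 < M := Real.log_pos (by nlinarith)
  have hexpM : Real.exp M = K * (1 + ‖s‖) ^ 3 := Real.exp_log (by positivity)
  have hre (z : ℂ) (hz : z ∈ Metric.ball c (3 / 2)) : (g z).re ≤ M := by
    rw [← Real.exp_le_exp, hexpM, ← norm_exp]
    have h1 : ‖riemannZeta₁ z‖ = ‖riemannZeta₁ c‖ * ‖exp (g z)‖ := by
      rw [← norm_mul, ← hg z hz]
    have h2 := hZ z (by linarith [(hball z hz).1])
    have h3 : (1 + ‖z‖) ^ 3 ≤ (5 * (1 + ‖s‖)) ^ 3 := by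
      gcongr
      linarith [(hball z hz).2, norm_nonneg s]
    have h4 : ‖riemannZeta₁ z‖ ≤ C₀ * (5 * (1 + ‖s‖)) ^ 3 := h2.trans (by gcongr)
    have h5 : 1 / 4 * ‖exp (g z)‖ ≤ ‖riemannZeta₁ c‖ * ‖exp (g z)‖ := by gcongr
    nlinarith
  have hs' : s ∈ Metric.ball c (3 / 2) := by
    rw [mem_ball_iff_norm, hscn]
    linarith
  have hBC := borelCaratheodory_zero (f := fun z => g (c + z)) (z := s - c) hM0
    (hgd.comp (by fun_prop) fun z hz => by simpa using hz)
    (fun z hz => hre (c + z) (by simpa using hz)) (by norm_num : (0 : ℝ) < 3 / 2)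
    (mem_ball_zero_iff.2 (mem_ball_iff_norm.1 hs')) (by simpa using hg0)
  rw [add_sub_cancel, hscn] at hBC
  have hgs : ‖g s‖ ≤ A * M := by
    refine hBC.trans ?_
    have h1 : 2 * M * (2 - s.re) / (3 / 2 - (2 - s.re)) ≤ 3 * M / δ := by
      apply div_le_div₀ (by positivity) (by nlinarith) hδ (by linarith)
    calc _ ≤ 3 * M / δ := h1
      _ = 3 / δ * M := by ring
      _ ≤ _ := by gcongr
  rw [hg s hs', norm_inv, norm_mul, norm_exp, mul_inv, ← Real.exp_neg]
  have h1 : Real.exp (-(g s).re) ≤ Real.exp (A * M) := by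
    refine Real.exp_le_exp.2 ?_
    linarith [neg_abs_le (g s).re, abs_re_le_norm (g s)]
  have h2 : ‖riemannZeta₁ c‖⁻¹ ≤ 4 := by
    rw [show (4 : ℝ) = (1 / 4)⁻¹ by norm_num]
    gcongr
  calc _ ≤ 4 * Real.exp (A * M) := by gcongr
    _ = _ := by rw [Real.exp_nat_mul, hexpM, mul_pow, ← pow_mul]; ring

open MeasureTheory in
lemma mellinW_eq_intervalIntegral {f : ℝ → ℝ} {a b : ℝ} (ha : 0 < a) (hab : a ≤ b)
    (hf : ∀ t ∉ Set.Icc a b, f t = 0) (s : ℂ) :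
    mellinW f s = ∫ t in a..b, (f t : ℂ) * (t : ℂ) ^ (s - 1) := by
  rw [mellinW, intervalIntegral.integral_of_le hab, ← integral_Icc_eq_integral_Ioc]
  refine setIntegral_eq_of_subset_of_forall_sdiff_eq_zero measurableSet_Ioi
    (fun t ht => ha.trans_le ht.1) fun t ht => ?_
  rw [hf t ht.2, ofReal_zero, zero_mul]

lemma one_add_mul_mellinW {f : ℝ → ℝ} {a b : ℝ} (ha : 0 < a) (hab : a ≤ b)
    (hf : ContDiff ℝ (⊤ : ℕ∞) f) (hf0 : ∀ t ∉ Set.Icc a b, f t = 0) (s : ℂ) :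
    (1 + s) * mellinW f s = mellinW (fun t => f t - t * deriv f t) s := by
  have hfd : Differentiable ℝ f := hf.differentiable (by simp)
  have hf'c : Continuous (deriv f) := hf.continuous_deriv (by simp)
  have hf' : ∀ t ∉ Set.Icc a b, deriv f t = 0 := fun t ht => by
    have : f =ᶠ[nhds t] fun _ => 0 := by
      filter_upwards [isClosed_Icc.isOpen_compl.mem_nhds ht] with u hu using hf0 u hu
    simpa using this.deriv_eq
  have ha' : a / 2 ∉ Set.Icc a b := fun h => by linarith [h.1]
  have hb' : b + 1 ∉ Set.Icc a b := fun h => by linarith [h.2]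
  have hsub : ∀ t ∉ Set.Icc (a / 2) (b + 1), t ∉ Set.Icc a b := fun t ht h =>
    ht ⟨by linarith [h.1], by linarith [h.2]⟩
  rw [mellinW_eq_intervalIntegral (half_pos ha) (by linarith) (fun t ht => hf0 t (hsub t ht)),
    mellinW_eq_intervalIntegral (half_pos ha) (by linarith : a / 2 ≤ b + 1)
      (fun t ht => by rw [hf0 t (hsub t ht), hf' t (hsub t ht)]; simp)]
  have hpos (t : ℝ) (ht : t ∈ Set.uIcc (a / 2) (b + 1)) : 0 < t := by
    rw [Set.uIcc_of_le (by linarith)] at ht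
    linarith [ht.1]
  have hcpow (r : ℂ) : ContinuousOn (fun t : ℝ => (t : ℂ) ^ r) (Set.uIcc (a / 2) (b + 1)) :=
    fun t ht => (continuousAt_ofReal_cpow_const t r (Or.inr (hpos t ht).ne')).continuousWithinAt
  have hint1 : IntervalIntegrable (fun t : ℝ => (f t : ℂ) * (t : ℂ) ^ (s - 1))
      MeasureTheory.volume (a / 2) (b + 1) :=
    ((continuous_ofReal.comp hf.continuous).continuousOn.mul (hcpow _)).intervalIntegrable
  have hint2 : IntervalIntegrable (fun t : ℝ => ((deriv f t : ℝ) : ℂ) * (t : ℂ) ^ s)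
      MeasureTheory.volume (a / 2) (b + 1) :=
    ((continuous_ofReal.comp hf'c).continuousOn.mul (hcpow _)).intervalIntegrable
  have hFTC := intervalIntegral.integral_eq_sub_of_hasDerivAt
    (f := fun t : ℝ => (f t : ℂ) * (t : ℂ) ^ s)
    (f' := fun t : ℝ => ((deriv f t : ℝ) : ℂ) * (t : ℂ) ^ s + s * ((f t : ℂ) * (t : ℂ) ^ (s - 1)))
    (fun t ht => by
      have h1 := (hfd t).hasDerivAt.ofReal_comp
      have h2 := ((hasDerivAt_id (t : ℂ)).cpow_const (c := s)
        (ofReal_mem_slitPlane.2 (hpos t ht))).comp_ofReal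
      convert! h1.mul h2 using 1
      simp
      ring) (hint2.add (hint1.const_mul s))
  rw [intervalIntegral.integral_add hint2 (hint1.const_mul s),
    intervalIntegral.integral_const_mul, hf0 _ ha', hf0 _ hb', ofReal_zero,
    zero_mul, zero_mul, sub_zero] at hFTC
  have hcongr : ∫ t in (a / 2)..(b + 1), ((f t - t * deriv f t : ℝ) : ℂ) * (t : ℂ) ^ (s - 1)
      = ∫ t in (a / 2)..(b + 1), ((f t : ℂ) * (t : ℂ) ^ (s - 1)
        - ((deriv f t : ℝ) : ℂ) * (t : ℂ) ^ s) := by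
    refine intervalIntegral.integral_congr fun t ht => ?_
    have ht0 : (t : ℂ) ≠ 0 := by exact_mod_cast (hpos t ht).ne'
    simp only [cpow_sub _ _ ht0, cpow_one]
    push_cast
    field_simp
  rw [hcongr, intervalIntegral.integral_sub hint1 hint2]
  linear_combination hFTC

lemma exists_norm_mellinW_le {f : ℝ → ℝ} {a b : ℝ} (ha : 0 < a) (hab : a ≤ b)
    (hf : Continuous f) (hf0 : ∀ t ∉ Set.Icc a b, f t = 0) :
    ∃ C : ℝ, 0 < C ∧ ∀ s : ℂ, 0 ≤ s.re → s.re ≤ 4 → ‖mellinW f s‖ ≤ C := by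
  obtain ⟨B, hB⟩ := isCompact_Icc.exists_bound_of_continuousOn (hf.continuousOn (s := Set.Icc a b))
  refine ⟨(|B| + 1) * (a⁻¹ + b ^ 3) * (b - a + 1), ?_, fun s hs hs4 => ?_⟩
  · have : 0 < b := ha.trans_le hab
    have : 0 < b - a + 1 := by linarith
    positivity
  have hb : 0 < b := ha.trans_le hab
  rw [mellinW_eq_intervalIntegral ha hab hf0]
  refine (intervalIntegral.norm_integral_le_of_norm_le_const
    (C := (|B| + 1) * (a⁻¹ + b ^ 3)) fun t ht => ?_).trans ?_
  · rw [Set.uIoc_of_le hab] at ht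
    have ht0 : 0 < t := ha.trans ht.1
    rw [norm_mul, norm_cpow_eq_rpow_re_of_pos ht0, norm_real]
    have h1 : ‖f t‖ ≤ |B| + 1 := (hB t ⟨ht.1.le, ht.2⟩).trans (by linarith [le_abs_self B])
    have h2 : t ^ (s - 1).re ≤ a⁻¹ + b ^ 3 := by
      rw [sub_re, one_re]
      rcases le_total t 1 with h | h
      · have : t ^ (s.re - 1) ≤ t ^ (-1 : ℝ) :=
          Real.rpow_le_rpow_of_exponent_ge ht0 h (by linarith)
        rw [Real.rpow_neg_one] at this
        have h3 : t⁻¹ ≤ a⁻¹ := inv_anti₀ ha ht.1.le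
        have : 0 < b ^ 3 := by positivity
        linarith
      · have : t ^ (s.re - 1) ≤ t ^ (3 : ℝ) :=
          Real.rpow_le_rpow_of_exponent_le h (by linarith)
        rw [show (3 : ℝ) = (3 : ℕ) by norm_num, Real.rpow_natCast] at this
        have h3 : t ^ 3 ≤ b ^ 3 := by gcongr; exact ht.2
        have : 0 < a⁻¹ := by positivity
        linarith
    gcongr
  · rw [abs_of_nonneg (by linarith : 0 ≤ b - a)]
    gcongr
    linarith

lemma exists_norm_mellinW_mul_pow_le {a b : ℝ} (ha : 0 < a) (hab : a ≤ b) (N : ℕ) :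
    ∀ {f : ℝ → ℝ}, ContDiff ℝ (⊤ : ℕ∞) f → (∀ t ∉ Set.Icc a b, f t = 0) →
    ∃ C : ℝ, 0 < C ∧ ∀ s : ℂ, 0 ≤ s.re → s.re ≤ 4 → ‖mellinW f s‖ * (1 + ‖s‖) ^ N ≤ C := by
  induction N with
  | zero =>
    intro f hf hf0
    simpa using exists_norm_mellinW_le ha hab hf.continuous hf0
  | succ N ih =>
    intro f hf hf0
    have hf' : ContDiff ℝ (⊤ : ℕ∞) (deriv f) :=
      (contDiff_infty_iff_deriv.1 hf).2
    obtain ⟨C, hC, h⟩ := ih (f := fun t => f t - t * deriv f t) (hf.sub (contDiff_id.mul hf'))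
      (fun t ht => by
        have : f =ᶠ[nhds t] fun _ => 0 := by
          filter_upwards [isClosed_Icc.isOpen_compl.mem_nhds ht] with u hu using hf0 u hu
        have h0 : deriv f t = 0 := by simpa using this.deriv_eq
        rw [hf0 t ht, h0, mul_zero, sub_zero])
    refine ⟨2 * C, by positivity, fun s hs hs4 => ?_⟩
    have h1 := h s hs hs4
    rw [← one_add_mul_mellinW ha hab hf hf0, norm_mul] at h1
    have h2 : 1 + ‖s‖ ≤ 2 * ‖1 + s‖ := by
      have h3 : 1 ≤ ‖1 + s‖ := by
        have := re_le_norm (1 + s)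
        rw [add_re, one_re] at this
        linarith
      have h4 : ‖s‖ ≤ ‖1 + s‖ := by
        rw [← sq_le_sq₀ (norm_nonneg _) (norm_nonneg _), Complex.sq_norm, Complex.sq_norm,
          normSq_apply, normSq_apply]
        simp
        nlinarith
      linarith
    calc ‖mellinW f s‖ * (1 + ‖s‖) ^ (N + 1) = (1 + ‖s‖) * (‖mellinW f s‖ * (1 + ‖s‖) ^ N) := by
          ring
      _ ≤ 2 * ‖1 + s‖ * (‖mellinW f s‖ * (1 + ‖s‖) ^ N) := by gcongr
      _ ≤ 2 * C := by linarith

lemma differentiable_mellinW {f : ℝ → ℝ} {a b : ℝ} (ha : 0 < a)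
    (hf : Continuous f) (hf0 : ∀ t ∉ Set.Icc a b, f t = 0) :
    Differentiable ℂ (mellinW f) := by
  have heq : mellinW f = mellin (fun t => (f t : ℂ)) := by
    funext s
    simp only [mellinW, mellin, smul_eq_mul, mul_comm]
  rw [heq]
  intro s
  refine mellin_differentiableAt_of_isBigO_rpow (a := s.re + 1) (b := s.re - 1)
    ((continuous_ofReal.comp hf).locallyIntegrable.locallyIntegrableOn _)
    ?_ (by linarith) ?_ (by linarith)
  · refine Asymptotics.IsBigO.congr' (Asymptotics.isBigO_zero _ _) ?_ EventuallyEq.rfl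
    filter_upwards [eventually_gt_atTop b] with t ht
    rw [hf0 t fun h => by linarith [h.2], ofReal_zero]
  · refine Asymptotics.IsBigO.congr' (Asymptotics.isBigO_zero _ _) ?_ EventuallyEq.rfl
    filter_upwards [nhdsWithin_le_nhds (Iio_mem_nhds ha)] with t ht
    rw [hf0 t fun h => not_lt.2 h.1 ht, ofReal_zero]

lemma VI_congr {c : ℝ} {f g : ℂ → ℂ} (h : ∀ s : ℂ, s.re = c → f s = g s) : VI c f = VI c g := by
  rw [VI, VI]
  congr 2
  funext t
  rw [h _ (by simp)]

open MeasureTheory in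
lemma norm_VI_le {c C : ℝ} {f : ℂ → ℂ} (h : ∀ s : ℂ, s.re = c → ‖f s‖ ≤ C * (1 + s.im ^ 2)⁻¹) :
    ‖VI c f‖ ≤ C := by
  have h1 : ‖∫ t : ℝ, f (c + t * I) * I‖ ≤ ∫ t : ℝ, C * (1 + t ^ 2)⁻¹ := by
    refine norm_integral_le_of_norm_le (integrable_inv_one_add_sq.const_mul C)
      (Eventually.of_forall fun t => ?_)
    simpa using h (c + t * I) (by simp)
  rw [integral_const_mul, integral_univ_inv_one_add_sq] at h1
  have hC : 0 ≤ C := by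
    by_contra! hC
    nlinarith [norm_nonneg (∫ t : ℝ, f (c + t * I) * I), Real.pi_pos]
  have h2 : ‖(1 / (2 * Real.pi * I) : ℂ)‖ = 1 / (2 * Real.pi) := by
    simp [Real.pi_pos.le]
  rw [VI, norm_mul, h2]
  calc _ ≤ 1 / (2 * Real.pi) * (C * Real.pi) := by gcongr
    _ = C / 2 := by field_simp
    _ ≤ C := by linarith

open MeasureTheory in
/-- Shifting the line of integration of a holomorphic function with quadratic decay. -/
lemma VI_eq_VI_of_differentiableAt {a b C : ℝ} {g : ℂ → ℂ}
    (hg : ∀ s : ℂ, s.re ∈ Set.uIcc a b → DifferentiableAt ℂ g s)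
    (hC : ∀ s : ℂ, s.re ∈ Set.uIcc a b → ‖g s‖ ≤ C * (1 + s.im ^ 2)⁻¹) :
    VI a g = VI b g := by
  have hint (c : ℝ) (hc : c ∈ Set.uIcc a b) : Integrable (fun t : ℝ => g (c + t * I)) := by
    have hcont : Continuous fun t : ℝ => g (c + t * I) :=
      continuous_iff_continuousAt.2 fun t =>
        (hg (c + t * I) (by simpa using hc)).continuousAt.comp
          (f := fun t : ℝ => (c + t * I : ℂ)) (by fun_prop)
    refine (integrable_inv_one_add_sq.const_mul C).mono' hcont.aestronglyMeasurable
      (Eventually.of_forall fun t => ?_)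
    simpa using hC (c + t * I) (by simpa using hc)
  have hlim (c : ℝ) (hc : c ∈ Set.uIcc a b) :
      Tendsto (fun T : ℝ => ∫ t in (-T)..T, g (c + t * I)) atTop
        (nhds (∫ t : ℝ, g (c + t * I))) :=
    intervalIntegral_tendsto_integral (hint c hc) tendsto_neg_atTop_atBot tendsto_id
  have hhor (σ : ℝ → ℝ) (hσ : ∀ T, σ T ^ 2 = T ^ 2) :
      Tendsto (fun T : ℝ => ∫ x in a..b, g (x + σ T * I)) atTop (nhds 0) := by
    have h0 : Tendsto (fun T : ℝ => C * (1 + T ^ 2)⁻¹ * |b - a|) atTop (nhds 0) := by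
      have : Tendsto (fun T : ℝ => (1 + T ^ 2)⁻¹) atTop (nhds 0) :=
        tendsto_inv_atTop_zero.comp
          (tendsto_atTop_add_const_left _ 1 (tendsto_pow_atTop two_ne_zero))
      simpa using (this.const_mul C).mul_const |b - a|
    refine squeeze_zero_norm (fun T => ?_) h0
    refine intervalIntegral.norm_integral_le_of_norm_le_const fun x hx => ?_
    have := hC (x + σ T * I) (by simpa using Set.uIoc_subset_uIcc hx)
    simpa [hσ] using this
  have hrect (T : ℝ) : (∫ x in a..b, g (x + (-T : ℝ) * I)) - (∫ x in a..b, g (x + T * I))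
      + I * (∫ t in (-T)..T, g (b + t * I)) = I * ∫ t in (-T)..T, g (a + t * I) := by
    have := integral_boundary_rect_eq_zero_of_differentiableOn g (a + (-T : ℝ) * I) (b + T * I)
      (fun s hs => (hg s (by
        rw [mem_reProdIm] at hs
        simpa using hs.1)).differentiableWithinAt)
    rw [sub_eq_zero] at this
    simpa using this
  have hl := (((hhor (fun T => -T) (by simp)).sub (hhor (fun T => T) (by simp))).add
    ((hlim b Set.right_mem_uIcc).const_mul I)).congr hrect
  have heq := tendsto_nhds_unique hl ((hlim a Set.left_mem_uIcc).const_mul I)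
  rw [sub_zero, zero_add] at heq
  rw [VI, VI, integral_mul_const, integral_mul_const, mul_left_cancel₀ I_ne_zero heq]

open MeasureTheory in
lemma VI_VI_swap {a b C : ℝ} {G : ℂ → ℂ → ℂ}
    (hG : Measurable fun p : ℝ × ℝ => G (a + p.1 * I) (b + p.2 * I))
    (hC : ∀ s₁ s₂ : ℂ, s₁.re = a → s₂.re = b →
      ‖G s₁ s₂‖ ≤ C * (1 + s₁.im ^ 2)⁻¹ * (1 + s₂.im ^ 2)⁻¹) :
    VI a (fun s₁ => VI b fun s₂ => G s₁ s₂) = VI b (fun s₂ => VI a fun s₁ => G s₁ s₂) := by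
  have hint : Integrable (Function.uncurry fun t u : ℝ => G (a + t * I) (b + u * I))
      (volume.prod volume) := by
    refine ((integrable_inv_one_add_sq.const_mul C).mul_prod integrable_inv_one_add_sq).mono'
      hG.aestronglyMeasurable (Eventually.of_forall fun p => ?_)
    simpa [Function.uncurry] using hC (a + p.1 * I) (b + p.2 * I) (by simp) (by simp)
  simp only [VI, integral_mul_const, integral_const_mul]
  rw [integral_integral_swap hint]

/-- The integrand of `C₂`, with the zeta factors expressed through the entire function
`riemannZeta₁`, so that its removable singularities disappear. -/
noncomputable def kernelC2 (W : ℝ → ℝ) (x y : ℝ) (s₁ s₂ : ℂ) : ℂ :=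
  riemannZeta₁ (2 - s₂) * (riemannZeta₁ s₂)⁻¹ *
      (riemannZeta₁ (1 - s₂ + s₁) * (1 - s₂ + s₁) * (s₂ - s₁)⁻¹ * (riemannZeta₁ (2 + s₁ - s₂))⁻¹) *
    (y : ℂ) ^ (2 - s₂) * mellinW W (2 - s₂) * (x : ℂ) ^ (s₁ + s₂) * mellinW W s₁ * mellinW W s₂

lemma kernelC2_eq (W : ℝ → ℝ) (x y : ℝ) {s₁ s₂ : ℂ} (h1 : 1 < s₂.re) (h2 : s₁.re < s₂.re)
    (h3 : s₂.re < 1 + s₁.re) :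
    riemannZeta (2 - s₂) * riemannZeta (1 - s₂ + s₁) /
        (riemannZeta (2 + s₁ - s₂) * riemannZeta s₂) *
      (y : ℂ) ^ (2 - s₂) * mellinW W (2 - s₂) * (x : ℂ) ^ (s₁ + s₂) * mellinW W s₁ * mellinW W s₂ =
    kernelC2 W x y s₁ s₂ := by
  have hre {z : ℂ} (hz : z.re ≠ 0) : z ≠ 0 := by rintro rfl; simp at hz
  have e1 : 1 - s₂ ≠ 0 := hre (by rw [sub_re, one_re]; linarith)
  have e2 : s₁ - s₂ ≠ 0 := hre (by rw [sub_re]; linarith)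
  have e3 : 1 + s₁ - s₂ ≠ 0 := hre (by rw [sub_re, add_re, one_re]; linarith)
  have e4 : s₂ - 1 ≠ 0 := fun h => e1 (by linear_combination -h)
  have e5 : s₂ - s₁ ≠ 0 := fun h => e2 (by linear_combination -h)
  have hζ {z w : ℂ} (hw : w ≠ 0) (h : z - 1 = w) : riemannZeta z = w⁻¹ * riemannZeta₁ z := by
    rw [← h, riemannZeta_eq_inv_sub_mul]
    exact sub_ne_zero.1 (h ▸ hw)
  rw [kernelC2, hζ (z := 2 - s₂) e1 (by ring), hζ (z := 1 - s₂ + s₁) e2 (by ring),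
    hζ (z := 2 + s₁ - s₂) e3 (by ring), hζ e4 rfl]
  have : (1 - s₂)⁻¹ * (s₁ - s₂)⁻¹ * (1 + s₁ - s₂) * (s₂ - 1) = (1 + s₁ - s₂) * (s₂ - s₁)⁻¹ := by
    rw [show s₂ - 1 = -(1 - s₂) by ring, show s₂ - s₁ = -(s₁ - s₂) by ring]
    field_simp
  rw [div_eq_mul_inv, mul_inv, mul_inv, mul_inv, inv_inv, inv_inv]
  linear_combination (riemannZeta₁ (2 - s₂) * (riemannZeta₁ s₂)⁻¹ *
    riemannZeta₁ (1 - s₂ + s₁) * (riemannZeta₁ (2 + s₁ - s₂))⁻¹ *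
    (y : ℂ) ^ (2 - s₂) * mellinW W (2 - s₂) * (x : ℂ) ^ (s₁ + s₂) * mellinW W s₁ *
    mellinW W s₂) * this

lemma measurable_kernelC2 {W : ℝ → ℝ} (hW : Differentiable ℂ (mellinW W)) (x y : ℝ)
    {α : Type*} [MeasurableSpace α] {p q : α → ℂ} (hp : Measurable p) (hq : Measurable q) :
    Measurable fun z => kernelC2 W x y (p z) (q z) := by
  have hM : Measurable (mellinW W) := hW.continuous.measurable
  have hZ : Measurable riemannZeta₁ := differentiable_riemannZeta₁.continuous.measurable
  unfold kernelC2
  fun_prop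

lemma differentiableAt_kernelC2 (hRH : RiemannHypothesis) {W : ℝ → ℝ}
    (hW : Differentiable ℂ (mellinW W)) {x y : ℝ} (hx : 0 < x) (hy : 0 < y) {p q : ℂ → ℂ} {z : ℂ}
    (hp : DifferentiableAt ℂ p z) (hq : DifferentiableAt ℂ q z) (h1 : 1 / 2 < (q z).re)
    (h2 : (p z).re < (q z).re) (h3 : (q z).re < 3 / 2 + (p z).re) :
    DifferentiableAt ℂ (fun z => kernelC2 W x y (p z) (q z)) z := by
  have hx' : (x : ℂ) ≠ 0 := by exact_mod_cast hx.ne'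
  have hy' : (y : ℂ) ≠ 0 := by exact_mod_cast hy.ne'
  have hM {f : ℂ → ℂ} (hf : DifferentiableAt ℂ f z) :
      DifferentiableAt ℂ (fun z => mellinW W (f z)) z := (hW (f z)).comp z hf
  have hZ {f : ℂ → ℂ} (hf : DifferentiableAt ℂ f z) :
      DifferentiableAt ℂ (fun z => riemannZeta₁ (f z)) z :=
    (differentiable_riemannZeta₁ (f z)).comp z hf
  have e1 : riemannZeta₁ (q z) ≠ 0 := hRH.riemannZeta₁_ne_zero h1
  have e2 : riemannZeta₁ (2 + p z - q z) ≠ 0 := hRH.riemannZeta₁_ne_zero (by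
    rw [sub_re, add_re, re_ofNat]; linarith)
  have e3 : q z - p z ≠ 0 := fun h => by
    have := congrArg re h
    rw [sub_re, zero_re] at this
    linarith
  unfold kernelC2
  have d1 := hq.const_sub 2
  have d2 := (hq.const_sub 1).add hp
  have d3 := (hp.const_add 2).sub hq
  exact (((((((hZ d1).mul ((hZ hq).inv e1)).mul ((((hZ d2).mul d2).mul ((hq.sub hp).inv e3)).mul
    ((hZ d3).inv e2))).mul (d1.const_cpow (Or.inl hy'))).mul (hM d1)).mul
    ((hp.add hq).const_cpow (Or.inl hx'))).mul (hM hp)).mul (hM hq)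

lemma exists_norm_kernelC2_le (hRH : RiemannHypothesis) {W : ℝ → ℝ} {a b : ℝ} (ha : 0 < a)
    (hab : a ≤ b) (hW : ContDiff ℝ (⊤ : ℕ∞) W) (hW0 : ∀ t ∉ Set.Icc a b, W t = 0) {δ : ℝ}
    (hδ : 0 < δ) (hδ2 : δ ≤ 1 / 2) :
    ∃ K : ℝ, 0 < K ∧ ∀ x y : ℝ, 0 < x → 0 < y → ∀ s₁ s₂ : ℂ, 0 ≤ s₁.re → s₁.re ≤ 2 →
      1 ≤ s₂.re → s₂.re ≤ 2 → δ ≤ s₂.re - s₁.re → s₂.re - s₁.re ≤ 3 / 2 - δ →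
      ‖kernelC2 W x y s₁ s₂‖ ≤ K * (y ^ (2 - s₂.re) * x ^ (s₁.re + s₂.re)) *
        (1 + s₁.im ^ 2)⁻¹ * (1 + s₂.im ^ 2)⁻¹ := by
  obtain ⟨C₀, hC₀, hZ⟩ := exists_norm_riemannZeta₁_le
  obtain ⟨A, C₁, hC₁, hZinv⟩ := hRH.exists_norm_inv_riemannZeta₁_le hδ
  obtain ⟨C₂, hC₂, hM⟩ := exists_norm_mellinW_le ha hab hW.continuous hW0
  obtain ⟨C₃, hC₃, hM'⟩ := exists_norm_mellinW_mul_pow_le ha hab (2 * A + 9) hW hW0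
  have hdecay (s : ℂ) (h0 : 0 ≤ s.re) (h4 : s.re ≤ 4) :
      (1 + ‖s‖) ^ (2 * A + 7) * ‖mellinW W s‖ ≤ C₃ * (1 + s.im ^ 2)⁻¹ := by
    rw [← div_eq_mul_inv, le_div_iff₀ (by positivity)]
    have h1 : 1 + s.im ^ 2 ≤ (1 + ‖s‖) ^ 2 := by
      have h2 : s.im ^ 2 ≤ ‖s‖ ^ 2 := by
        rw [← sq_abs s.im]
        gcongr
        exact abs_im_le_norm s
      nlinarith [norm_nonneg s]
    calc _ ≤ (1 + ‖s‖) ^ (2 * A + 7) * ‖mellinW W s‖ * (1 + ‖s‖) ^ 2 := by gcongr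
      _ = ‖mellinW W s‖ * (1 + ‖s‖) ^ (2 * A + 9) := by ring
      _ ≤ C₃ := hM' s h0 h4
  refine ⟨C₀ * 3 ^ 3 * C₁ * (C₀ * 2 ^ 3 * 2 * δ⁻¹ * (C₁ * 3 ^ A)) * C₂ * C₃ * C₃, by positivity,
    fun x y hx hy s₁ s₂ h10 h12 h21 h22 hw hw' => ?_⟩
  set u := 1 + ‖s₁‖ with hu
  set v := 1 + ‖s₂‖ with hv
  have hu1 : 1 ≤ u := by simp [hu]
  have hv1 : 1 ≤ v := by simp [hv]
  have n1 : ‖riemannZeta₁ (2 - s₂)‖ ≤ C₀ * (3 * v) ^ 3 := by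
    refine (hZ _ (by rw [sub_re, re_ofNat]; linarith)).trans ?_
    have := norm_sub_le 2 s₂
    rw [norm_ofNat] at this
    gcongr
    linarith [norm_nonneg s₂]
  have n2 : ‖(riemannZeta₁ s₂)⁻¹‖ ≤ C₁ * v ^ A := hZinv _ (by linarith) (by linarith)
  have hw1 : 1 + ‖1 - s₂ + s₁‖ ≤ 2 * (u * v) := by
    have h1 := norm_add_le (1 - s₂) s₁
    have h2 := norm_sub_le 1 s₂
    rw [norm_one] at h2
    nlinarith [mul_nonneg (norm_nonneg s₁) (norm_nonneg s₂), norm_nonneg s₁, norm_nonneg s₂]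
  have n3 : ‖riemannZeta₁ (1 - s₂ + s₁)‖ ≤ C₀ * (2 * (u * v)) ^ 3 := by
    refine (hZ _ (by rw [add_re, sub_re, one_re]; linarith)).trans ?_
    gcongr
  have n4 : ‖1 - s₂ + s₁‖ ≤ 2 * (u * v) := by linarith
  have n5 : ‖(s₂ - s₁)⁻¹‖ ≤ δ⁻¹ := by
    rw [norm_inv]
    refine inv_anti₀ hδ (hw.trans ?_)
    simpa using re_le_norm (s₂ - s₁)
  have n6 : ‖(riemannZeta₁ (2 + s₁ - s₂))⁻¹‖ ≤ C₁ * (3 * (u * v)) ^ A := by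
    refine (hZinv _ (by rw [sub_re, add_re, re_ofNat]; linarith)
      (by rw [sub_re, add_re, re_ofNat]; linarith)).trans ?_
    have h1 := norm_sub_le (2 + s₁) s₂
    have h2 := norm_add_le 2 s₁
    rw [norm_ofNat] at h2
    gcongr
    nlinarith [mul_nonneg (norm_nonneg s₁) (norm_nonneg s₂), norm_nonneg s₁, norm_nonneg s₂]
  have n7 : ‖mellinW W (2 - s₂)‖ ≤ C₂ :=
    hM _ (by rw [sub_re, re_ofNat]; linarith) (by rw [sub_re, re_ofNat]; linarith)
  have ny : ‖(y : ℂ) ^ (2 - s₂)‖ = y ^ (2 - s₂.re) := by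
    rw [norm_cpow_eq_rpow_re_of_pos hy, sub_re, re_ofNat]
  have nx : ‖(x : ℂ) ^ (s₁ + s₂)‖ = x ^ (s₁.re + s₂.re) := by
    rw [norm_cpow_eq_rpow_re_of_pos hx, add_re]
  have hu' : u ^ (A + 4) ≤ u ^ (2 * A + 7) := pow_le_pow_right₀ hu1 (by omega)
  have hd1 := hdecay s₁ h10 (by linarith)
  have hd2 := hdecay s₂ (by linarith) (by linarith)
  rw [← hu] at hd1
  rw [← hv] at hd2
  simp only [kernelC2, norm_mul, ny, nx]
  set Y := y ^ (2 - s₂.re)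
  set X := x ^ (s₁.re + s₂.re)
  have hY : 0 ≤ Y := by positivity
  have hX : 0 ≤ X := by positivity
  calc _ ≤ C₀ * (3 * v) ^ 3 * (C₁ * v ^ A) * (C₀ * (2 * (u * v)) ^ 3 * (2 * (u * v)) * δ⁻¹ *
        (C₁ * (3 * (u * v)) ^ A)) * Y * C₂ * X * ‖mellinW W s₁‖ * ‖mellinW W s₂‖ := by gcongr
    _ = C₀ * 3 ^ 3 * C₁ * (C₀ * 2 ^ 3 * 2 * δ⁻¹ * (C₁ * 3 ^ A)) * C₂ * (Y * X) *
        (u ^ (A + 4) * ‖mellinW W s₁‖) * (v ^ (2 * A + 7) * ‖mellinW W s₂‖) := by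
      simp only [mul_pow]
      ring
    _ ≤ C₀ * 3 ^ 3 * C₁ * (C₀ * 2 ^ 3 * 2 * δ⁻¹ * (C₁ * 3 ^ A)) * C₂ * (Y * X) *
        (C₃ * (1 + s₁.im ^ 2)⁻¹) * (C₃ * (1 + s₂.im ^ 2)⁻¹) := by
      have : u ^ (A + 4) * ‖mellinW W s₁‖ ≤ C₃ * (1 + s₁.im ^ 2)⁻¹ :=
        le_trans (by gcongr) hd1
      gcongr
    _ = _ := by ring

/-- Under RH, the bound `C₂ ≪ y^{1/2+ε} x^{3/2+ε}`. -/
theorem C2_bound (hRH : RiemannHypothesis) (ε : ℝ) (hε : 0 < ε)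
    (U : ℝ) (hU : 2 ≤ U) (W : Weight U)
    (c₁ c₂ : ℝ) (h1 : 1 < c₁) (h12 : c₁ < c₂) (h2 : c₂ < 2) :
    ∃ C : ℝ, 0 < C ∧ ∃ X : ℝ, ∀ x y : ℝ, X ≤ x → x < y →
      ‖VI c₁ (fun s₁ => VI c₂ (fun s₂ =>
          riemannZeta (2 - s₂) * riemannZeta (1 - s₂ + s₁) /
              (riemannZeta (2 + s₁ - s₂) * riemannZeta s₂) *
            (y : ℂ) ^ (2 - s₂) * mellinW W.toFun (2 - s₂) *
            (x : ℂ) ^ (s₁ + s₂) * mellinW W.toFun s₁ * mellinW W.toFun s₂))‖ ≤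
        C * (y ^ ((1 : ℝ) / 2 + ε) * x ^ ((3 : ℝ) / 2 + ε)) := by
  set a : ℝ := 1 / (2 * U) with ha_def
  set b : ℝ := 1 + 1 / (2 * U) with hb_def
  have ha : 0 < a := by positivity
  have hab : a ≤ b := by linarith
  have hM : Differentiable ℂ (mellinW W.toFun) :=
    differentiable_mellinW ha W.smooth.continuous W.support_subset
  set η : ℝ := min ε (1 / 8) with hη_def
  have hη : 0 < η := lt_min hε (by norm_num)
  have hηε : η ≤ ε := min_le_left _ _
  have hη8 : η ≤ 1 / 8 := min_le_right _ _
  obtain ⟨δ, hδ, hδη, hδc, hδ2, hδ12⟩ : ∃ δ : ℝ, 0 < δ ∧ δ ≤ 2 * η ∧ δ ≤ c₂ - c₁ ∧ δ ≤ 2 - c₂ ∧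
      δ ≤ 1 / 2 :=
    ⟨min (min (2 * η) (c₂ - c₁)) (min (2 - c₂) (1 / 2)),
      lt_min (lt_min (by linarith) (by linarith)) (lt_min (by linarith) (by norm_num)),
      (min_le_left _ _).trans (min_le_left _ _), (min_le_left _ _).trans (min_le_right _ _),
      (min_le_right _ _).trans (min_le_left _ _), (min_le_right _ _).trans (min_le_right _ _)⟩
  obtain ⟨K, hK, hbound⟩ := exists_norm_kernelC2_le hRH ha hab W.smooth W.support_subset hδ hδ12
  refine ⟨K, hK, 1, fun x y hx hxy => ?_⟩
  have hx0 : 0 < x := by linarith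
  have hy1 : 1 ≤ y := by linarith
  have hy0 : 0 < y := by linarith
  let Admissible (σ₁ σ₂ : ℝ) : Prop := (0 ≤ σ₁ ∧ σ₁ ≤ 2) ∧ (1 ≤ σ₂ ∧ σ₂ ≤ 2) ∧
    δ ≤ σ₂ - σ₁ ∧ σ₂ - σ₁ ≤ 3 / 2 - δ
  set F := kernelC2 W.toFun x y with hF
  have hF_le (s₁ s₂ : ℂ) (h : Admissible s₁.re s₂.re) :
      ‖F s₁ s₂‖ ≤ K * (y ^ (2 : ℝ) * x ^ (4 : ℝ)) * (1 + s₁.im ^ 2)⁻¹ * (1 + s₂.im ^ 2)⁻¹ := by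
    obtain ⟨⟨h10, h12⟩, ⟨h21, h22⟩, hw, hw'⟩ := h
    refine (hbound x y hx0 hy0 s₁ s₂ h10 h12 h21 h22 hw hw').trans ?_
    gcongr
    · linarith
    · linarith
  have swap (σ₁ σ₂ : ℝ) (h : Admissible σ₁ σ₂) :
      VI σ₁ (fun s₁ => VI σ₂ fun s₂ => F s₁ s₂) = VI σ₂ (fun s₂ => VI σ₁ fun s₁ => F s₁ s₂) :=
    VI_VI_swap (measurable_kernelC2 hM x y (by fun_prop) (by fun_prop))
      fun s₁ s₂ h₁ h₂ => hF_le s₁ s₂ (by rwa [h₁, h₂])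
  have shift₂ (σ₁ σ₂ σ₂' : ℝ) (h : ∀ σ ∈ Set.uIcc σ₂ σ₂', Admissible σ₁ σ) :
      VI σ₁ (fun s₁ => VI σ₂ fun s₂ => F s₁ s₂) = VI σ₁ (fun s₁ => VI σ₂' fun s₂ => F s₁ s₂) := by
    refine VI_congr fun s₁ hs₁ => ?_
    refine VI_eq_VI_of_differentiableAt (fun s₂ hs₂ => ?_)
      (fun s₂ hs₂ => hF_le s₁ s₂ (by rw [hs₁]; exact h _ hs₂))
    obtain ⟨-, ⟨h21, h22⟩, hw, hw'⟩ := h _ hs₂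
    exact differentiableAt_kernelC2 hRH hM hx0 hy0 (differentiableAt_const s₁) differentiableAt_fun_id
      (by linarith) (by linarith) (by linarith)
  have shift₁ (σ₁ σ₁' σ₂ : ℝ) (h : ∀ σ ∈ Set.uIcc σ₁ σ₁', Admissible σ σ₂) :
      VI σ₁ (fun s₁ => VI σ₂ fun s₂ => F s₁ s₂) = VI σ₁' (fun s₁ => VI σ₂ fun s₂ => F s₁ s₂) := by
    rw [swap _ _ (h _ Set.left_mem_uIcc), swap _ _ (h _ Set.right_mem_uIcc)]
    refine VI_congr fun s₂ hs₂ => ?_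
    refine VI_eq_VI_of_differentiableAt (C := K * (y ^ (2 : ℝ) * x ^ (4 : ℝ)) * (1 + s₂.im ^ 2)⁻¹)
      (fun s₁ hs₁ => ?_)
      (fun s₁ hs₁ => (hF_le s₁ s₂ (by rw [hs₂]; exact h _ hs₁)).trans_eq (mul_right_comm _ _ _))
    obtain ⟨-, ⟨h21, h22⟩, hw, hw'⟩ := h _ hs₁
    exact differentiableAt_kernelC2 hRH hM hx0 hy0 differentiableAt_fun_id (differentiableAt_const s₂)
      (by linarith) (by linarith) (by linarith)
  have hI : VI c₁ (fun s₁ => VI c₂ fun s₂ =>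
      riemannZeta (2 - s₂) * riemannZeta (1 - s₂ + s₁) /
          (riemannZeta (2 + s₁ - s₂) * riemannZeta s₂) *
        (y : ℂ) ^ (2 - s₂) * mellinW W.toFun (2 - s₂) *
        (x : ℂ) ^ (s₁ + s₂) * mellinW W.toFun s₁ * mellinW W.toFun s₂) =
      VI c₁ (fun s₁ => VI c₂ fun s₂ => F s₁ s₂) :=
    VI_congr fun s₁ hs₁ => VI_congr fun s₂ hs₂ =>
      kernelC2_eq _ _ _ (by linarith) (by linarith) (by linarith)
  have hpath {p q r : ℝ} (h : r ∈ Set.uIcc p q) : (p ≤ r ∨ q ≤ r) ∧ (r ≤ p ∨ r ≤ q) := by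
    rw [Set.mem_uIcc] at h
    tauto
  rw [hI, shift₁ c₁ (1 / 2) c₂ (fun σ hσ => by
      rw [Set.uIcc_of_ge (by linarith)] at hσ
      obtain ⟨h3, h4⟩ := hσ
      refine ⟨⟨?_, ?_⟩, ⟨?_, ?_⟩, ?_, ?_⟩ <;> linarith),
    shift₂ (1 / 2) c₂ (3 / 2 - η) (fun σ hσ => by
      obtain ⟨h3, h4⟩ := hpath hσ
      refine ⟨⟨?_, ?_⟩, ⟨?_, ?_⟩, ?_, ?_⟩ <;>
        rcases h3 with h3 | h3 <;> rcases h4 with h4 | h4 <;> linarith),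
    shift₁ (1 / 2) η (3 / 2 - η) (fun σ hσ => by
      rw [Set.uIcc_of_ge (by linarith)] at hσ
      obtain ⟨h3, h4⟩ := hσ
      refine ⟨⟨?_, ?_⟩, ⟨?_, ?_⟩, ?_, ?_⟩ <;> linarith)]
  have hfinal : ‖VI η (fun s₁ => VI (3 / 2 - η) fun s₂ => F s₁ s₂)‖ ≤
      K * (y ^ (2 - (3 / 2 - η)) * x ^ (η + (3 / 2 - η))) := by
    refine norm_VI_le fun s₁ hs₁ => norm_VI_le fun s₂ hs₂ => ?_
    rw [← hs₂, ← hs₁]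
    exact hbound x y hx0 hy0 s₁ s₂ (by linarith) (by linarith) (by linarith) (by linarith)
      (by linarith) (by linarith)
  refine hfinal.trans ?_
  have hyle := Real.rpow_le_rpow_of_exponent_le hy1
    (by linarith : 2 - (3 / 2 - η) ≤ (1 : ℝ) / 2 + ε)
  have hxle := Real.rpow_le_rpow_of_exponent_le hx
    (by linarith : η + (3 / 2 - η) ≤ (3 : ℝ) / 2 + ε)
  gcongr K * (?_ * ?_)
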